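/- (Conformal non-null case, T(Z) is a single point.) Let Z ∈ (ℝⁿ)* be a row covector with ⟨Z,Z⟩ ≠ 0. A column vector X ∈ ℝⁿ satisfies both ⁅⁅ι₊(Z), ι₋(X)⁆, ι₋(X)⁆ = −2 ι₋(X) and ⁅⁅ι₊(Z), ι₋(X)⁆, ι₊(Z)⁆ = 2 ι₊(Z) if and only if X = (2/⟨Z,Z⟩) IZᵀ. -/

import Mathlib

open Matrix

/-- Index type for (n+2)×(n+2) block matrices with blocks of sizes 1, n, 1. -/
abbrev Idx (n : ℕ) := Unit ⊕ Fin n ⊕ Unit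

/-- The diagonal entries of the signature matrix I = diag(Id_p, −Id_q). -/
def sig (p q : ℕ) : Fin (p + q) → ℝ := fun i => if (i : ℕ) < p then 1 else -1

/-- The n×n signature matrix I = diag(Id_p, −Id_q). -/
def sigMat (p q : ℕ) : Matrix (Fin (p + q)) (Fin (p + q)) ℝ := Matrix.diagonal (sig p q)

/-- The inner product of signature (p,q): ⟨X,Y⟩ = Xᵀ I Y (the same formula gives
Z I Wᵀ for row covectors). -/
def form (p q : ℕ) (X Y : Fin (p + q) → ℝ) : ℝ := ∑ i, X i * sig p q i * Y i

/-- The column vector I Zᵀ associated to a row covector Z (written `starr`) (equally, the row covector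
Xᵀ I associated to a column vector X). -/
def iFlip (p q : ℕ) (Z : Fin (p + q) → ℝ) : Fin (p + q) → ℝ := fun i => sig p q i * Z i

/-- Embedding of g₋₁ ≅ ℝⁿ into so(p+1,q+1): (2,1)-block X, (3,2)-block −XᵀI. -/
def iotaMinus (p q : ℕ) (X : Fin (p + q) → ℝ) : Matrix (Idx (p + q)) (Idx (p + q)) ℝ :=
  Matrix.of fun i j =>
    match i, j with
    | Sum.inr (Sum.inl i), Sum.inl _ => X i
    | Sum.inr (Sum.inr _), Sum.inr (Sum.inl j) => -(X j * sig p q j)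
    | _, _ => 0

/-- Embedding of g₁ ≅ (ℝⁿ)* into so(p+1,q+1): (1,2)-block Z, (2,3)-block −IZᵀ. -/
def iotaPlus (p q : ℕ) (Z : Fin (p + q) → ℝ) : Matrix (Idx (p + q)) (Idx (p + q)) ℝ :=
  Matrix.of fun i j =>
    match i, j with
    | Sum.inl _, Sum.inr (Sum.inl j) => Z j
    | Sum.inr (Sum.inl i), Sum.inr (Sum.inr _) => -(sig p q i * Z i)
    | _, _ => 0

/-- Embedding of g₀ into so(p+1,q+1): block diagonal matrix diag(a, A, −a). -/
def iotaZero (p q : ℕ) (A : Matrix (Fin (p + q)) (Fin (p + q)) ℝ) (a : ℝ) :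
    Matrix (Idx (p + q)) (Idx (p + q)) ℝ :=
  Matrix.of fun i j =>
    match i, j with
    | Sum.inl _, Sum.inl _ => a
    | Sum.inr (Sum.inl i), Sum.inr (Sum.inl j) => A i j
    | Sum.inr (Sum.inr _), Sum.inr (Sum.inr _) => -a
    | _, _ => 0

lemma sig_mul_self (p q : ℕ) (i : Fin (p + q)) : sig p q i * sig p q i = 1 := by
  unfold sig
  split_ifs <;> norm_num

lemma iFlip_involutive (p q : ℕ) : Function.Involutive (iFlip p q) := fun X => by
  funext i
  simp [iFlip, ← mul_assoc, sig_mul_self]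

lemma iFlip_smul (p q : ℕ) (c : ℝ) (X : Fin (p + q) → ℝ) :
    iFlip p q (c • X) = c • iFlip p q X := by
  funext i
  simp [iFlip, mul_left_comm]

lemma form_eq_dotProduct_iFlip (p q : ℕ) (X Y : Fin (p + q) → ℝ) :
    form p q X Y = X ⬝ᵥ iFlip p q Y := by
  simp [form, iFlip, dotProduct, mul_assoc]

lemma form_eq_iFlip_dotProduct (p q : ℕ) (X Y : Fin (p + q) → ℝ) :
    form p q X Y = iFlip p q X ⬝ᵥ Y := by
  simp [form, iFlip, dotProduct, mul_comm]

lemma iotaMinus_injective (p q : ℕ) : Function.Injective (iotaMinus p q) := fun X Y h => by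
  funext i
  simpa [iotaMinus] using congrFun (congrFun h (Sum.inr (Sum.inl i))) (Sum.inl ())

lemma iotaPlus_injective (p q : ℕ) : Function.Injective (iotaPlus p q) := fun X Y h => by
  funext i
  simpa [iotaPlus] using congrFun (congrFun h (Sum.inl ())) (Sum.inr (Sum.inl i))

lemma smul_iotaMinus (p q : ℕ) (c : ℝ) (X : Fin (p + q) → ℝ) :
    c • iotaMinus p q X = iotaMinus p q (c • X) := by
  ext (_ | i | _) (_ | j | _) <;> simp [iotaMinus, mul_assoc]

lemma smul_iotaPlus (p q : ℕ) (c : ℝ) (Z : Fin (p + q) → ℝ) :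
    c • iotaPlus p q Z = iotaPlus p q (c • Z) := by
  ext (_ | i | _) (_ | j | _) <;> simp [iotaPlus, mul_left_comm]

lemma lie_iotaPlus_iotaMinus (p q : ℕ) (Z X : Fin (p + q) → ℝ) :
    ⁅iotaPlus p q Z, iotaMinus p q X⁆ =
      iotaZero p q (vecMulVec (iFlip p q Z) (iFlip p q X) - vecMulVec X Z) (Z ⬝ᵥ X) := by
  ext (_ | i | _) (_ | j | _) <;>
    simp [Ring.lie_def, Matrix.mul_apply, iotaPlus, iotaMinus, iotaZero, iFlip, vecMulVec_apply,
      dotProduct, mul_comm]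
  refine Finset.sum_congr rfl fun i _ => ?_
  linear_combination (X i * Z i) * sig_mul_self p q i

lemma lie_iotaZero_iotaMinus (p q : ℕ) {A : Matrix (Fin (p + q)) (Fin (p + q)) ℝ}
    (hA : ∀ i j, sig p q i * A i j = -(sig p q j * A j i)) (a : ℝ) (X : Fin (p + q) → ℝ) :
    ⁅iotaZero p q A a, iotaMinus p q X⁆ = iotaMinus p q (A *ᵥ X - a • X) := by
  ext (_ | i | _) (_ | j | _) <;>
    simp [Ring.lie_def, Matrix.mul_apply, iotaMinus, iotaZero, mulVec, dotProduct, mul_comm]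
  have h : ∑ i, A i j * (X i * sig p q i) = -∑ i, sig p q j * (A j i * X i) := by
    rw [← Finset.sum_neg_distrib]
    exact Finset.sum_congr rfl fun i _ => by linear_combination X i * hA i j
  rw [mul_sub, Finset.mul_sum]
  linear_combination h

lemma lie_iotaZero_iotaPlus (p q : ℕ) {A : Matrix (Fin (p + q)) (Fin (p + q)) ℝ}
    (hA : ∀ i j, sig p q i * A i j = -(sig p q j * A j i)) (a : ℝ) (Z : Fin (p + q) → ℝ) :
    ⁅iotaZero p q A a, iotaPlus p q Z⁆ = iotaPlus p q (a • Z - Z ᵥ* A) := by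
  ext (_ | i | _) (_ | j | _) <;>
    simp [Ring.lie_def, Matrix.mul_apply, iotaPlus, iotaZero, vecMul, dotProduct, mul_comm]
  have h : ∑ j, A i j * (Z j * sig p q j) = -∑ j, sig p q i * (A j i * Z j) := by
    rw [← Finset.sum_neg_distrib]
    refine Finset.sum_congr rfl fun j _ => ?_
    linear_combination sig p q i * sig p q j * Z j * hA i j -
      A i j * sig p q j * Z j * sig_mul_self p q i - sig p q i * Z j * A j i * sig_mul_self p q j
  rw [mul_sub, Finset.mul_sum]
  linear_combination -h

lemma vecMulVec_sub_skew (p q : ℕ) (Z X : Fin (p + q) → ℝ) (i j : Fin (p + q)) :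
    sig p q i * (vecMulVec (iFlip p q Z) (iFlip p q X) - vecMulVec X Z) i j =
      -(sig p q j * (vecMulVec (iFlip p q Z) (iFlip p q X) - vecMulVec X Z) j i) := by
  simp only [Matrix.sub_apply, vecMulVec_apply, iFlip]
  linear_combination Z i * sig p q j * X j * sig_mul_self p q i +
    Z j * sig p q i * X i * sig_mul_self p q j

lemma lie_lie_iotaMinus (p q : ℕ) (Z X : Fin (p + q) → ℝ) :
    ⁅⁅iotaPlus p q Z, iotaMinus p q X⁆, iotaMinus p q X⁆ =
      iotaMinus p q (form p q X X • iFlip p q Z - (2 * (Z ⬝ᵥ X)) • X) := by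
  rw [lie_iotaPlus_iotaMinus, lie_iotaZero_iotaMinus p q (vecMulVec_sub_skew p q Z X)]
  congr 1
  rw [sub_mulVec, vecMulVec_mulVec, vecMulVec_mulVec, ← form_eq_iFlip_dotProduct]
  funext i
  simp
  ring

lemma lie_lie_iotaPlus (p q : ℕ) (Z X : Fin (p + q) → ℝ) :
    ⁅⁅iotaPlus p q Z, iotaMinus p q X⁆, iotaPlus p q Z⁆ =
      iotaPlus p q ((2 * (Z ⬝ᵥ X)) • Z - form p q Z Z • iFlip p q X) := by
  rw [lie_iotaPlus_iotaMinus, lie_iotaZero_iotaPlus p q (vecMulVec_sub_skew p q Z X)]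
  congr 1
  rw [vecMul_sub, vecMul_vecMulVec, vecMul_vecMulVec, ← form_eq_dotProduct_iFlip]
  funext i
  simp
  ring

/-- Conformal non-null case, T(Z) is a single point: for ⟨Z,Z⟩ ≠ 0,
⁅⁅ι₊(Z), ι₋(X)⁆, ι₋(X)⁆ = −2ι₋(X) and ⁅⁅ι₊(Z), ι₋(X)⁆, ι₊(Z)⁆ = 2ι₊(Z)
iff X = (2/⟨Z,Z⟩) IZᵀ. -/
theorem conformal_nonnull_TZ (p q : ℕ) (hn : 3 ≤ p + q) (Z : Fin (p + q) → ℝ)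
    (hZ : form p q Z Z ≠ 0) (X : Fin (p + q) → ℝ) :
    (⁅⁅iotaPlus p q Z, iotaMinus p q X⁆, iotaMinus p q X⁆ = (-2 : ℝ) • iotaMinus p q X ∧
     ⁅⁅iotaPlus p q Z, iotaMinus p q X⁆, iotaPlus p q Z⁆ = (2 : ℝ) • iotaPlus p q Z) ↔
    X = (2 / form p q Z Z) • iFlip p q Z := by
  rw [lie_lie_iotaMinus, lie_lie_iotaPlus, smul_iotaMinus, smul_iotaPlus,
    (iotaMinus_injective p q).eq_iff, (iotaPlus_injective p q).eq_iff]
  constructor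
  · rintro ⟨-, h⟩
    have hX : X = ((2 * (Z ⬝ᵥ X) - 2) / form p q Z Z) • iFlip p q Z := by
      rw [← iFlip_smul, ← (iFlip_involutive p q).injective.eq_iff, iFlip_involutive p q]
      funext i
      have hi := congrFun h i
      simp only [Pi.sub_apply, Pi.smul_apply, smul_eq_mul] at hi ⊢
      field_simp
      linear_combination -hi
    have hc : Z ⬝ᵥ X = 2 * (Z ⬝ᵥ X) - 2 := by
      conv_lhs => rw [hX, dotProduct_smul, ← form_eq_dotProduct_iFlip, smul_eq_mul]
      exact div_mul_cancel₀ _ hZ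
    rwa [← hc, show Z ⬝ᵥ X = 2 by linarith] at hX
  · intro hX
    have hc : Z ⬝ᵥ X = 2 := by
      rw [hX, dotProduct_smul, ← form_eq_dotProduct_iFlip, smul_eq_mul, div_mul_cancel₀ _ hZ]
    have hf : iFlip p q X = (2 / form p q Z Z) • Z := by
      rw [hX, iFlip_smul, iFlip_involutive p q]
    have hXX : form p q X X = 2 / form p q Z Z * 2 := by
      rw [form_eq_iFlip_dotProduct, hf, smul_dotProduct, hc, smul_eq_mul]
    rw [hc, hXX, hf]
    constructor <;> funext i
    · have hi := congrFun hX i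
      simp only [Pi.sub_apply, Pi.smul_apply, smul_eq_mul] at hi ⊢
      linear_combination -2 * hi
    · simp only [Pi.sub_apply, Pi.smul_apply, smul_eq_mul]
      field_simp
      ring
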